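/- Let G be the simple graph on six vertices v1,...,v6 whose edges are the path edges v1v2, v2v3, v3v4, v4v5, v5v6 together with the chords v2v4 and v4v6 (the graph G^6_64). Then the crossing numbers of the Cartesian products G □ C_3, G □ C_4 and G □ C_5 are 6, 8 and 10 respectively. -/

import Mathlib

open SimpleGraph

/-- A drawing of a simple graph in the plane: vertices are mapped to distinct
points, and each edge is mapped to a simple arc (parametrised by `[0,1]`)
joining the images of its endpoints and avoiding the images of all vertices
in its interior. -/
structure Drawing {V : Type*} (G : SimpleGraph V) where
  vertexMap : V → ℝ × ℝ
  vertexMap_injective : Function.Injective vertexMap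
  arc : G.edgeSet → ℝ → ℝ × ℝ
  arc_continuousOn : ∀ e, ContinuousOn (arc e) (Set.Icc 0 1)
  arc_injOn : ∀ e, Set.InjOn (arc e) (Set.Icc 0 1)
  arc_endpoints : ∀ e : G.edgeSet, ∃ u v : V,
    (e : Sym2 V) = s(u, v) ∧ arc e 0 = vertexMap u ∧ arc e 1 = vertexMap v
  arc_avoids_vertices : ∀ e : G.edgeSet, ∀ t ∈ Set.Ioo (0 : ℝ) 1, ∀ w : V,
    arc e t ≠ vertexMap w

/-- The crossings of a drawing: an unordered pair of distinct edges together
with a point of the plane where the two corresponding arcs intersect away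
from their endpoints. -/
def Drawing.crossings {V : Type*} {G : SimpleGraph V} (D : Drawing G) :
    Set (Sym2 G.edgeSet × (ℝ × ℝ)) :=
  { x | ∃ e f : G.edgeSet, e ≠ f ∧ x.1 = s(e, f) ∧
      (∃ s ∈ Set.Ioo (0 : ℝ) 1, D.arc e s = x.2) ∧
      (∃ t ∈ Set.Ioo (0 : ℝ) 1, D.arc f t = x.2) }

/-- The crossing number of a simple graph: the minimum number of crossings
over all drawings of the graph in the plane. -/
noncomputable def crossingNumber {V : Type*} (G : SimpleGraph V) : ℕ :=
  sInf { n : ℕ | ∃ D : Drawing G, D.crossings.Finite ∧ D.crossings.ncard = n }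

/-- The graph `G⁶₆₄`: the path `v1 v2 v3 v4 v5 v6` together with the chords `v2v4` and `v4v6`. -/
def G6_64 : SimpleGraph (Fin 6) :=
  SimpleGraph.fromEdgeSet {s(0, 1), s(1, 2), s(2, 3), s(3, 4), s(4, 5), s(1, 3), s(3, 5)}

/-- A nowhere vanishing continuous function on a simply connected space has a continuous
logarithm. -/
theorem exists_continuous_log {A : Type*} [TopologicalSpace A] [SimplyConnectedSpace A]
    [LocallyPathConnectedSpace A] {f : A → ℂ} (hf : Continuous f) (h0 : ∀ a, f a ≠ 0) :
    ∃ L : A → ℂ, Continuous L ∧ ∀ a, Complex.exp (L a) = f a := by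
  obtain ⟨a₀⟩ : Nonempty A := inferInstance
  obtain ⟨F, ⟨-, hF⟩, -⟩ := Complex.isCoveringMapOn_exp.existsUnique_continuousMap_lifts
    ⟨f, hf⟩ (a₀ := a₀) (e₀ := Complex.log (f a₀)) (Complex.exp_log (h0 a₀)) h0
  exact ⟨F, F.continuous, fun a => congrFun hF a⟩

/-- Two continuous logarithms of the same function have the same increments. -/
theorem continuous_log_sub_eq {A : Type*} [TopologicalSpace A] [SimplyConnectedSpace A]
    [LocallyPathConnectedSpace A] {L L' : A → ℂ} (hL : Continuous L) (hL' : Continuous L')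
    (h : ∀ a, Complex.exp (L a) = Complex.exp (L' a)) (a b : A) :
    L b - L a = L' b - L' a := by
  obtain ⟨F, -, hF⟩ := Complex.isCoveringMapOn_exp.existsUnique_continuousMap_lifts
    (⟨fun x => Complex.exp (L x), by fun_prop⟩ : C(A, ℂ)) (a₀ := a) (e₀ := L a) rfl
    (fun x => Complex.exp_ne_zero _)
  have h1 := hF ⟨L, hL⟩ ⟨rfl, rfl⟩
  have h2 := hF ⟨fun x => L' x + (L a - L' a), by fun_prop⟩ ⟨by simp, by
    funext x
    have : Complex.exp (L a - L' a) = 1 := by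
      rw [Complex.exp_sub, h a, div_self (Complex.exp_ne_zero _)]
    simp [Complex.exp_add, this, h x]⟩
  have h3 := congrArg (fun f : C(A, ℂ) => f b) (h1.trans h2.symm)
  simp only [ContinuousMap.coe_mk] at h3
  rw [h3]; ring

/-- The increment of a continuous logarithm of `α - p` along the path `α` differs from the increment
of the principal logarithm by an integer multiple of `2πi`. -/
theorem exists_winding_integer {α : ℝ → ℂ} (hα : Continuous α) (p : ℂ) :
    ∃ m : ℤ, (∀ s, α s ≠ p) → ∀ L : ℝ → ℂ, Continuous L → ∀ c : ℂ,
      (∀ s, Complex.exp (L s) = c * (α s - p)) →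
      L 1 - L 0 =
        Complex.log (α 1 - p) - Complex.log (α 0 - p) + m * (2 * Real.pi * Complex.I) := by
  by_cases hp : ∀ s, α s ≠ p
  swap
  · exact ⟨0, fun h => absurd h hp⟩
  obtain ⟨M, hM, hMe⟩ := exists_continuous_log (f := fun s => α s - p) (by fun_prop)
    (fun s => sub_ne_zero.2 (hp s))
  obtain ⟨m₁, h₁⟩ := Complex.exp_eq_exp_iff_exists_int.1
    ((hMe 1).trans (Complex.exp_log (sub_ne_zero.2 (hp 1))).symm)
  obtain ⟨m₀, h₀⟩ := Complex.exp_eq_exp_iff_exists_int.1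
    ((hMe 0).trans (Complex.exp_log (sub_ne_zero.2 (hp 0))).symm)
  refine ⟨m₁ - m₀, fun _ L hL c hc => ?_⟩
  have hc0 : c ≠ 0 := by
    rintro rfl
    exact Complex.exp_ne_zero (L 0) (by simpa using hc 0)
  have := continuous_log_sub_eq (L := L) (L' := fun s => M s + Complex.log c) hL (by fun_prop)
    (fun s => by rw [hc, Complex.exp_add, hMe, Complex.exp_log hc0, mul_comm]) 0 1
  rw [this, h₁, h₀]
  push_cast
  ring

/-- The two choices of principal logarithm of `z` and `-z` differ by an odd multiple of
`πi`. -/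
theorem exists_log_sub_log_neg {z : ℂ} (hz : z ≠ 0) :
    ∃ k : ℤ, Complex.log z - Complex.log (-z) = (1 - 2 * k) * (Real.pi * Complex.I) := by
  have h : Complex.exp (Complex.log z) = Complex.exp (Complex.log (-z) + Real.pi * Complex.I) := by
    rw [Complex.exp_add, Complex.exp_log hz, Complex.exp_log (neg_ne_zero.2 hz),
      Complex.exp_pi_mul_I]
    ring
  obtain ⟨n, hn⟩ := Complex.exp_eq_exp_iff_exists_int.1 h
  refine ⟨-n, ?_⟩
  rw [hn]; push_cast; ring

/-- If two paths do not meet, the boundary increments of the logarithm of their difference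
cancel. -/
theorem winding_integer_relation {α β : ℝ → ℂ} (hα : Continuous α) (hβ : Continuous β)
    (hd : ∀ s t, α s ≠ β t) {k : ℂ → ℂ → ℤ}
    (hk : ∀ p q, p ≠ q → Complex.log (p - q) - Complex.log (q - p) =
      (1 - 2 * k p q) * (Real.pi * Complex.I)) {mα mβ : ℂ → ℤ}
    (hmα : ∀ p, (∀ s, α s ≠ p) → ∀ L : ℝ → ℂ, Continuous L → ∀ c : ℂ,
      (∀ s, Complex.exp (L s) = c * (α s - p)) →
      L 1 - L 0 =
        Complex.log (α 1 - p) - Complex.log (α 0 - p) + mα p * (2 * Real.pi * Complex.I))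
    (hmβ : ∀ p, (∀ s, β s ≠ p) → ∀ L : ℝ → ℂ, Continuous L → ∀ c : ℂ,
      (∀ s, Complex.exp (L s) = c * (β s - p)) →
      L 1 - L 0 =
        Complex.log (β 1 - p) - Complex.log (β 0 - p) + mβ p * (2 * Real.pi * Complex.I)) :
    k (α 0) (β 0) - k (α 1) (β 0) - k (α 0) (β 1) + k (α 1) (β 1)
      + mα (β 0) - mα (β 1) + mβ (α 1) - mβ (α 0) = 0 := by
  obtain ⟨L, hL, hLe⟩ := exists_continuous_log (A := ℝ × ℝ) (f := fun x => α x.1 - β x.2)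
    (by fun_prop) (fun x => sub_ne_zero.2 (hd _ _))
  have e1 := hmα (β 0) (fun s => hd s 0) (fun s => L (s, 0)) (by fun_prop) 1 (by simp [hLe])
  have e2 := hmα (β 1) (fun s => hd s 1) (fun s => L (s, 1)) (by fun_prop) 1 (by simp [hLe])
  have e3 := hmβ (α 0) (fun s => (hd 0 s).symm) (fun s => L (0, s)) (by fun_prop) (-1)
    (by simp [hLe])
  have e4 := hmβ (α 1) (fun s => (hd 1 s).symm) (fun s => L (1, s)) (by fun_prop) (-1)
    (by simp [hLe])
  have f00 := hk _ _ (hd 0 0)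
  have f01 := hk _ _ (hd 0 1)
  have f10 := hk _ _ (hd 1 0)
  have f11 := hk _ _ (hd 1 1)
  have hπ : (2 * Real.pi * Complex.I : ℂ) ≠ 0 := Complex.two_pi_I_ne_zero
  have : ((k (α 0) (β 0) - k (α 1) (β 0) - k (α 0) (β 1) + k (α 1) (β 1)
      + mα (β 0) - mα (β 1) + mβ (α 1) - mβ (α 0) : ℤ) : ℂ) * (2 * Real.pi * Complex.I) = 0 := by
    push_cast
    linear_combination e2 - e1 + e3 - e4 + f00 - f01 - f10 + f11
  exact_mod_cast (mul_eq_zero.1 this).resolve_right hπ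

/-- The parity of the number of crossings of the edges `ab` and `cd` in a drawing described by
`τ` (a reference drawing of the complete graph) and `m` (the passages of edges over vertices). -/
def crossingParity {V : Type*} (τ : V → V → ZMod 2) (m : Sym2 V → V → ZMod 2) (a b c d : V) :
    ZMod 2 :=
  τ a c + τ a d + τ b c + τ b d + m s(a, b) c + m s(a, b) d + m s(c, d) a + m s(c, d) b

/-- Every drawing has associated data `τ`, `m` for which independent edges with disjoint arcs have
even crossing parity. -/
theorem Drawing.exists_crossingParity {V : Type*} {G : SimpleGraph V} (D : Drawing G) :
    ∃ (τ : V → V → ZMod 2) (m : Sym2 V → V → ZMod 2), (∀ u v, u ≠ v → τ u v + τ v u = 1) ∧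
      ∀ a b c d (e f : G.edgeSet), (e : Sym2 V) = s(a, b) → (f : Sym2 V) = s(c, d) →
        a ≠ c → a ≠ d → b ≠ c → b ≠ d →
        (∀ s ∈ Set.Ioo (0 : ℝ) 1, ∀ t ∈ Set.Ioo (0 : ℝ) 1, D.arc e s ≠ D.arc f t) →
        crossingParity τ m a b c d = 0 := by
  classical
  have hk : ∀ p q : ℂ, ∃ k : ℤ, p ≠ q → Complex.log (p - q) - Complex.log (q - p) =
      (1 - 2 * k) * (Real.pi * Complex.I) := fun p q => by
    by_cases h : p = q
    · exact ⟨0, fun h' => absurd h h'⟩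
    · obtain ⟨k, hk⟩ := exists_log_sub_log_neg (sub_ne_zero.2 h)
      exact ⟨k, fun _ => by rw [← hk, neg_sub]⟩
  choose k hk using hk
  let α : G.edgeSet → ℝ → ℂ := fun e s =>
    Complex.equivRealProdCLM.symm
      (Set.IccExtend zero_le_one ((Set.Icc 0 1).domRestrict (D.arc e)) s)
  have hα : ∀ e, Continuous (α e) := fun e =>
    Complex.equivRealProdCLM.symm.continuous.comp (D.arc_continuousOn e).domRestrict.Icc_extend'
  let z : V → ℂ := fun v => Complex.equivRealProdCLM.symm (D.vertexMap v)
  have hz : Function.Injective z :=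
    Complex.equivRealProdCLM.symm.injective.comp D.vertexMap_injective
  have α0 : ∀ e, α e 0 = Complex.equivRealProdCLM.symm (D.arc e 0) := fun e => by
    simp [α, Set.domRestrict_apply]
  have α1 : ∀ e, α e 1 = Complex.equivRealProdCLM.symm (D.arc e 1) := fun e => by
    simp [α, Set.domRestrict_apply]
  choose n hn using fun e p => exists_winding_integer (hα e) p
  let m : Sym2 V → V → ZMod 2 := fun e v =>
    if h : e ∈ G.edgeSet then (n ⟨e, h⟩ (z v) : ZMod 2) else 0
  refine ⟨fun u v => k (z u) (z v), m, fun u v huv => ?_, ?_⟩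
  · have h1 := hk _ _ (hz.ne huv)
    have h2 := hk _ _ (hz.ne huv.symm)
    have h3 : (k (z u) (z v) + k (z v) (z u) : ℂ) = 1 := by
      have hπ : (2 * Real.pi * Complex.I : ℂ) ≠ 0 := Complex.two_pi_I_ne_zero
      apply mul_right_cancel₀ hπ
      linear_combination h1 + h2
    have h4 : k (z u) (z v) + k (z v) (z u) = 1 := by exact_mod_cast h3
    simpa using congrArg (Int.cast : ℤ → ZMod 2) h4
  intro a b c d e f he hf hac had hbc hbd hdisj
  have hmem : ∀ e : G.edgeSet, ∀ s ∈ Set.Icc (0 : ℝ) 1,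
      s ∈ Set.Ioo (0 : ℝ) 1 ∨ ∃ v ∈ (e : Sym2 V), D.arc e s = D.vertexMap v := by
    intro e s hs
    obtain ⟨u, v, huv, h0, h1⟩ := D.arc_endpoints e
    rcases hs.1.eq_or_lt with rfl | h0s
    · exact .inr ⟨u, by simp [huv], h0⟩
    rcases hs.2.eq_or_lt with rfl | h1s
    · exact .inr ⟨v, by simp [huv], h1⟩
    exact .inl ⟨h0s, h1s⟩
  have hd : ∀ s t, α e s ≠ α f t := by
    intro s t hst
    have hst := Complex.equivRealProdCLM.symm.injective hst
    simp only [Set.IccExtend, Function.comp_apply, Set.domRestrict_apply] at hst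
    generalize hs' : (Set.projIcc (0 : ℝ) 1 zero_le_one s) = s' at hst
    generalize ht' : (Set.projIcc (0 : ℝ) 1 zero_le_one t) = t' at hst
    rcases hmem e s' s'.2 with h1 | ⟨v, hv, h1⟩
    · rcases hmem f t' t'.2 with h2 | ⟨w, hw, h2⟩
      · exact hdisj _ h1 _ h2 hst
      · exact D.arc_avoids_vertices e s' h1 w (hst.trans h2)
    · rcases hmem f t' t'.2 with h2 | ⟨w, hw, h2⟩
      · exact D.arc_avoids_vertices f t' h2 v (hst.symm.trans h1)
      · have := D.vertexMap_injective (h1.symm.trans (hst.trans h2))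
        subst this
        rw [he] at hv
        rw [hf] at hw
        simp only [Sym2.mem_iff] at hv hw
        grind
  have key := winding_integer_relation (hα e) (hα f) hd hk (hn e) (hn f)
  have key2 := congrArg (Int.cast : ℤ → ZMod 2) key
  push_cast at key2
  simp only [CharTwo.sub_eq_add, α0, α1] at key2
  have hme : ∀ v, m s(a, b) v = n e (z v) := fun v => by
    have : s(a, b) ∈ G.edgeSet := he ▸ e.2
    simp only [m, dif_pos this]
    congr!
    exact he.symm
  have hmf : ∀ v, m s(c, d) v = n f (z v) := fun v => by
    have : s(c, d) ∈ G.edgeSet := hf ▸ f.2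
    simp only [m, dif_pos this]
    congr!
    exact hf.symm
  obtain ⟨u, v, huv, hu, hv⟩ := D.arc_endpoints e
  obtain ⟨u', v', huv', hu', hv'⟩ := D.arc_endpoints f
  rw [hu, hv, hu', hv'] at key2
  change (k (z u) (z u') : ZMod 2) + k (z v) (z u') + k (z u) (z v') + k (z v) (z v')
    + n e (z u') + n e (z v') + n f (z v) + n f (z u) = 0 at key2
  simp only [crossingParity, hme, hmf]
  rw [he, Sym2.eq_iff] at huv
  rw [hf, Sym2.eq_iff] at huv'
  rcases huv with ⟨rfl, rfl⟩ | ⟨rfl, rfl⟩ <;> rcases huv' with ⟨rfl, rfl⟩ | ⟨rfl, rfl⟩ <;>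
    linear_combination key2

/-- The crossing parity of two disjoint edges is symmetric. -/
theorem crossingParity_comm {V : Type*} {τ : V → V → ZMod 2} {m : Sym2 V → V → ZMod 2}
    (hτ : ∀ u v, u ≠ v → τ u v + τ v u = 1) {a b c d : V}
    (hac : a ≠ c) (had : a ≠ d) (hbc : b ≠ c) (hbd : b ≠ d) :
    crossingParity τ m a b c d = crossingParity τ m c d a b := by
  have h2 : (2 : ZMod 2) = 0 := rfl
  simp only [crossingParity]
  linear_combination hτ a c hac + hτ a d had + hτ b c hbc + hτ b d hbd
    - (τ c a + τ d a + τ c b + τ d b - 2) * h2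

/-- The van Kampen relation for a subdivision of `K₅` with branch vertices `a, b, c, a₀, a₂`: the
edges `aᵢb` and `aᵢc` are subdivided by `bᵢ` and `cᵢ`, and the edge `a₀a₂` is replaced by a path
whose passages over vertices are recorded by `M`. -/
theorem sum_crossingParity_K5 {V : Type*} {τ : V → V → ZMod 2} {m : Sym2 V → V → ZMod 2}
    (hτ : ∀ u v, u ≠ v → τ u v + τ v u = 1) (M : V → ZMod 2) {a b c a₀ b₀ c₀ a₂ b₂ c₂ : V}
    (hd : [a, b, c, a₀, b₀, c₀, a₂, b₂, c₂].Nodup) :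
    (τ b a₀ + τ b a₂ + τ c a₀ + τ c a₂ + m s(b, c) a₀ + m s(b, c) a₂ + M b + M c)
    + (τ c a₀ + τ c a₂ + τ a a₀ + τ a a₂ + m s(c, a) a₀ + m s(c, a) a₂ + M c + M a)
    + (τ a a₀ + τ a a₂ + τ b a₀ + τ b a₂ + m s(a, b) a₀ + m s(a, b) a₂ + M a + M b)
    + (crossingParity τ m b c a₀ a + crossingParity τ m b c a a₂)
    + (crossingParity τ m c a a₀ b₀ + crossingParity τ m c a b₀ b
      + crossingParity τ m c a a₂ b₂ + crossingParity τ m c a b b₂)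
    + (crossingParity τ m a b c₀ a₀ + crossingParity τ m a b c₀ c
      + crossingParity τ m a b c₂ a₂ + crossingParity τ m a b c c₂)
    + (crossingParity τ m a₀ a b b₂ + crossingParity τ m a₀ a c c₂
      + crossingParity τ m b₀ b c c₂ + crossingParity τ m b₀ b a a₂
      + crossingParity τ m c₀ c a a₂ + crossingParity τ m c₀ c b b₂)
    + (crossingParity τ m a₀ b₀ a a₂ + crossingParity τ m a₀ b₀ c c₂
      + crossingParity τ m a₀ b₀ c₂ a₂
      + crossingParity τ m c₀ a₀ a a₂ + crossingParity τ m c₀ a₀ b b₂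
      + crossingParity τ m c₀ a₀ a₂ b₂
      + crossingParity τ m a₂ b₂ a₀ a + crossingParity τ m a₂ b₂ c₀ c
      + crossingParity τ m c₂ a₂ a₀ a + crossingParity τ m c₂ a₂ b₀ b) = 1 := by
  have h2 : ∀ x : ZMod 2, x + x = 0 := CharTwo.add_self_eq_zero
  have := hτ a a₀; have := hτ a b₀; have := hτ a c₀
  have := hτ a a₂; have := hτ a b₂; have := hτ a c₂
  have := hτ b a₀; have := hτ b b₀; have := hτ b c₀
  have := hτ b a₂; have := hτ b b₂; have := hτ b c₂
  have := hτ c a₀; have := hτ c b₀; have := hτ c c₀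
  have := hτ c a₂; have := hτ c b₂; have := hτ c c₂
  have := hτ a b; have := hτ b c; have := hτ c a
  have := hτ a₀ b₀; have := hτ b₀ c₀; have := hτ c₀ a₀
  have := hτ a₂ b₂; have := hτ b₂ c₂; have := hτ c₂ a₂
  have := hτ a₀ a₂; have := hτ a₀ b₂; have := hτ a₀ c₂
  have := hτ b₀ a₂; have := hτ b₀ b₂; have := hτ b₀ c₂
  have := hτ c₀ a₂; have := hτ c₀ b₂; have := hτ c₀ c₂
  clear hτ
  simp only [List.nodup_cons, List.mem_cons, not_or, List.not_mem_nil] at hd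
  simp_all only [ne_eq, not_false_eq_true, forall_const, crossingParity]
  grind

section TriangleProduct

variable {n : ℕ} (τ : Fin 3 × Fin n → Fin 3 × Fin n → ZMod 2)
  (m : Sym2 (Fin 3 × Fin n) → Fin 3 × Fin n → ZMod 2)

/-- The crossing parity of two edges of the triangles at levels `k` and `l` of `C₃ □ Cₙ`; each edge
is named by the opposite vertex. -/
def triTriParity (k l : Fin n) (a b : Fin 3) : ZMod 2 :=
  crossingParity τ m (a + 1, k) (a + 2, k) (b + 1, l) (b + 2, l)

/-- The number of pairs of edges of two triangles that cross oddly. -/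
def triTriCount (k l : Fin n) : ℕ := ∑ b, ∑ a, (triTriParity τ m k l a b).val

variable {τ m}

theorem triTriCount_eq_zero {k l : Fin n} (h : triTriCount τ m k l = 0) (a b : Fin 3) :
    triTriParity τ m k l a b = 0 := by
  simpa using Finset.sum_eq_zero_iff.1 (Finset.sum_eq_zero_iff.1 h b (Finset.mem_univ _)) a
    (Finset.mem_univ _)

theorem triTriParity_comm (hτ : ∀ u v, u ≠ v → τ u v + τ v u = 1) {k l : Fin n} (h : k ≠ l)
    (a b : Fin 3) : triTriParity τ m k l a b = triTriParity τ m l k b a := by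
  apply crossingParity_comm hτ <;> simp [h]

theorem triTriCount_comm (hτ : ∀ u v, u ≠ v → τ u v + τ v u = 1) {k l : Fin n} (h : k ≠ l) :
    triTriCount τ m k l = triTriCount τ m l k := by
  rw [triTriCount, Finset.sum_comm, triTriCount]
  simp only [triTriParity_comm hτ h]

theorem even_triTriCount (k l : Fin n) : Even (triTriCount τ m k l) := by
  rw [← ZMod.natCast_eq_zero_iff_even]
  have h2 : (2 : ZMod 2) = 0 := rfl
  simp only [triTriCount, Nat.cast_sum, ZMod.natCast_zmod_val]
  simp only [Fin.sum_univ_three, triTriParity, crossingParity]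
  simp only [show (0 : Fin 3) + 1 = 1 from rfl, show (0 : Fin 3) + 2 = 2 from rfl,
    show (1 : Fin 3) + 1 = 2 from rfl, show (1 : Fin 3) + 2 = 0 from rfl,
    show (2 : Fin 3) + 1 = 0 from rfl, show (2 : Fin 3) + 2 = 1 from rfl]
  ring_nf
  reduce_mod_char

variable [NeZero n] (τ m)

/-- The crossing parity of an edge of the triangle at level `k` and the spoke from level `j` to
level `j + 1` at `b`, set to zero if these edges are adjacent. -/
def triSpokeParity (k j : Fin n) (a b : Fin 3) : ZMod 2 :=
  if k ≠ j ∧ k ≠ j + 1 ∨ a = b then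
    crossingParity τ m (a + 1, k) (a + 2, k) (b, j) (b, j + 1) else 0

/-- The crossing parity of spokes on the two sides of level `i + 1`, set to zero if these edges are
adjacent. -/
def spokeSpokeParity (i : Fin n) (a b : Fin 3) : ZMod 2 :=
  if a ≠ b then crossingParity τ m (a, i) (a, i + 1) (b, i + 1) (b, i + 1 + 1) else 0

/-- The number of pairs of a triangle edge and an independent spoke that cross oddly. -/
def triSpokeCount (k j : Fin n) : ℕ := ∑ b, ∑ a, (triSpokeParity τ m k j a b).val

/-- The number of independent pairs of spokes at level `i + 1` that cross oddly. -/
def spokeSpokeCount (i : Fin n) : ℕ := ∑ b, ∑ a, (spokeSpokeParity τ m i a b).val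

variable {τ m}

theorem triSpokeCount_eq_zero {k j : Fin n} (h : triSpokeCount τ m k j = 0) (a b : Fin 3) :
    triSpokeParity τ m k j a b = 0 := by
  simpa using Finset.sum_eq_zero_iff.1 (Finset.sum_eq_zero_iff.1 h b (Finset.mem_univ _)) a
    (Finset.mem_univ _)

theorem spokeSpokeCount_eq_zero {i : Fin n} (h : spokeSpokeCount τ m i = 0) (a b : Fin 3) :
    spokeSpokeParity τ m i a b = 0 := by
  simpa using Finset.sum_eq_zero_iff.1 (Finset.sum_eq_zero_iff.1 h b (Finset.mem_univ _)) a
    (Finset.mem_univ _)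

theorem sum_triangle_quadrilateral {k j : Fin n} (hkj : k ≠ j) (hkj' : k ≠ j + 1) (a : Fin 3) :
    ∑ d, (triSpokeParity τ m k j d a + triSpokeParity τ m k j d (a + 1)
      + triTriParity τ m k j d (a + 2) + triTriParity τ m k (j + 1) d (a + 2)) = 0 := by
  have h2 : ∀ x : ZMod 2, x + x = 0 := CharTwo.add_self_eq_zero
  have ha : a + 2 + 1 = a := by revert a; decide
  have ha' : a + 2 + 2 = a + 1 := by revert a; decide
  simp only [Fin.sum_univ_three, triTriParity, triSpokeParity, hkj, hkj', ne_eq, not_false_eq_true,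
    and_self, true_or, if_true, crossingParity, ha, ha']
  simp only [show (0 : Fin 3) + 1 = 1 from rfl, show (0 : Fin 3) + 2 = 2 from rfl,
    show (1 : Fin 3) + 1 = 2 from rfl, show (1 : Fin 3) + 2 = 0 from rfl,
    show (2 : Fin 3) + 1 = 0 from rfl, show (2 : Fin 3) + 2 = 1 from rfl]
  grind

theorem sum_parity_around_triangle (hτ : ∀ u v, u ≠ v → τ u v + τ v u = 1)
    (h₁ : ∀ k : Fin n, k + 1 ≠ k) (h₂ : ∀ k : Fin n, k + 1 + 1 ≠ k) (k : Fin n) (a : Fin 3) :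
    (∑ d, ∑ j ∈ {k, k + 1}ᶜ, triSpokeParity τ m (k + 1) j d a)
    + (triSpokeParity τ m (k + 1) k a a + triSpokeParity τ m (k + 1) (k + 1) a a)
    + (triTriParity τ m (k + 1) k (a + 1) (a + 2) + triSpokeParity τ m (k + 1) k (a + 1) (a + 1)
      + triTriParity τ m (k + 1) (k + 1 + 1) (a + 1) (a + 2)
      + triSpokeParity τ m (k + 1) (k + 1) (a + 1) (a + 1))
    + (triTriParity τ m (k + 1) k (a + 2) (a + 1) + triSpokeParity τ m (k + 1) k (a + 2) (a + 2)
      + triTriParity τ m (k + 1) (k + 1 + 1) (a + 2) (a + 1)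
      + triSpokeParity τ m (k + 1) (k + 1) (a + 2) (a + 2))
    + (spokeSpokeParity τ m k a (a + 1) + spokeSpokeParity τ m k a (a + 2)
      + spokeSpokeParity τ m k (a + 1) (a + 2) + spokeSpokeParity τ m k (a + 1) a
      + spokeSpokeParity τ m k (a + 2) a + spokeSpokeParity τ m k (a + 2) (a + 1))
    + (triSpokeParity τ m k (k + 1) (a + 2) a + triSpokeParity τ m k (k + 1) (a + 2) (a + 2)
      + triTriParity τ m k (k + 1 + 1) (a + 2) (a + 1)
      + triSpokeParity τ m k (k + 1) (a + 1) a + triSpokeParity τ m k (k + 1) (a + 1) (a + 1)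
      + triTriParity τ m k (k + 1 + 1) (a + 1) (a + 2)
      + triSpokeParity τ m (k + 1 + 1) k (a + 2) a
      + triSpokeParity τ m (k + 1 + 1) k (a + 2) (a + 2)
      + triSpokeParity τ m (k + 1 + 1) k (a + 1) a
      + triSpokeParity τ m (k + 1 + 1) k (a + 1) (a + 1)) = 1 := by
  have h2 : ∀ x : ZMod 2, x + x = 0 := CharTwo.add_self_eq_zero
  have a11 : a + 1 + 1 = a + 2 := by revert a; decide
  have a12 : a + 1 + 2 = a := by revert a; decide
  have a21 : a + 2 + 1 = a := by revert a; decide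
  have a22 : a + 2 + 2 = a + 1 := by revert a; decide
  have n1 : a ≠ a + 1 := by revert a; decide
  have n2 : a ≠ a + 2 := by revert a; decide
  have n3 : a + 1 ≠ a + 2 := by revert a; decide
  have g1 := h₁ k
  have g2 := h₁ (k + 1)
  have g3 := h₂ k
  set M : Fin 3 × Fin n → ZMod 2 := fun v => ∑ j ∈ {k, k + 1}ᶜ, m s((a, j), (a, j + 1)) v with hM
  have htel : ∀ g : Fin n → ZMod 2, ∑ j ∈ {k, k + 1}ᶜ, (g j + g (j + 1)) = g k + g (k + 1 + 1) := by
    intro g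
    have e1 := Finset.sum_add_sum_compl {k, k + 1} (fun j => g j + g (j + 1))
    rw [Finset.sum_pair g1.symm, Finset.sum_add_distrib (s := Finset.univ),
      show ∑ j, g (j + 1) = ∑ j, g j from Equiv.sum_comp (Equiv.addRight (1 : Fin n)) g, h2] at e1
    grind
  have hfar : ∀ u v : Fin 3, ∑ j ∈ {k, k + 1}ᶜ,
      crossingParity τ m (u, k + 1) (v, k + 1) (a, j) (a, j + 1) =
      τ (u, k + 1) (a, k) + τ (u, k + 1) (a, k + 1 + 1) + τ (v, k + 1) (a, k)
        + τ (v, k + 1) (a, k + 1 + 1) + m s((u, k + 1), (v, k + 1)) (a, k)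
        + m s((u, k + 1), (v, k + 1)) (a, k + 1 + 1) + M (u, k + 1) + M (v, k + 1) := by
    intro u v
    have e1 := htel fun j => τ (u, k + 1) (a, j) + τ (v, k + 1) (a, j)
      + m s((u, k + 1), (v, k + 1)) (a, j)
    simp only [hM, crossingParity]
    rw [← sub_eq_zero] at e1 ⊢
    rw [← e1]
    simp only [Finset.sum_add_distrib]
    ring
  have hts : ∀ d, ∑ j ∈ {k, k + 1}ᶜ, triSpokeParity τ m (k + 1) j d a = ∑ j ∈ {k, k + 1}ᶜ,
      crossingParity τ m (d + 1, k + 1) (d + 2, k + 1) (a, j) (a, j + 1) := by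
    intro d
    refine Finset.sum_congr rfl fun j hj => ?_
    rw [triSpokeParity, if_pos]
    simp only [Finset.mem_compl, Finset.mem_insert, Finset.mem_singleton, not_or] at hj
    exact .inl ⟨fun h => hj.2 h.symm, fun h => hj.1 (add_right_cancel h.symm)⟩
  have hsum : ∀ g : Fin 3 → ZMod 2, ∑ d, g d = g a + g (a + 1) + g (a + 2) := by
    intro g
    rw [Fin.sum_univ_three]
    fin_cases a <;> simp <;> ring
  have key := sum_crossingParity_K5 (m := m) hτ M (a := (a, k + 1)) (b := (a + 1, k + 1))
    (c := (a + 2, k + 1)) (a₀ := (a, k)) (b₀ := (a + 1, k)) (c₀ := (a + 2, k))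
    (a₂ := (a, k + 1 + 1)) (b₂ := (a + 1, k + 1 + 1)) (c₂ := (a + 2, k + 1 + 1)) (by
      simp [n1, n2, n3, g1, g2.symm, g3.symm])
  simp only [hsum, hts, hfar, a11, a12, a21, a22]
  simp only [triTriParity, triSpokeParity, spokeSpokeParity, a11, a12, a21, a22, g1, g1.symm, g2,
    g2.symm, g3, g3.symm, n1, n1.symm, n2, n2.symm, n3, n3.symm, ne_eq, not_false_eq_true, and_self,
    true_or, or_true, if_true]
  exact key

/-- The counting behind `crossings_near_clean_level`. The functions `U`, `U'`, `R` record the odd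
crossings of the lower triangle with the upper spokes, of the upper triangle with the lower spokes,
and of the two triangles. -/
theorem count_of_parity_relations {U U' R : Fin 3 → Fin 3 → ZMod 2}
    (hK : ∀ a, U (a + 2) a + U (a + 2) (a + 2) + R (a + 2) (a + 1)
      + U (a + 1) a + U (a + 1) (a + 1) + R (a + 1) (a + 2)
      + U' (a + 2) a + U' (a + 2) (a + 2) + U' (a + 1) a + U' (a + 1) (a + 1) = 1)
    (hR : Even (∑ b, ∑ a, (R a b).val))
    (hU : ∀ a, ∑ d, (U d a + U d (a + 1) + R d (a + 2)) = 0)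
    (hU' : ∀ a, ∑ d, (U' d a + U' d (a + 1) + R (a + 2) d) = 0) :
    1 ≤ ∑ b, ∑ a, (R a b).val + ∑ b, ∑ a, (U a b).val + ∑ b, ∑ a, (U' a b).val ∧
    (∑ b, ∑ a, (R a b).val ≠ 0 →
      3 ≤ ∑ b, ∑ a, (R a b).val + ∑ b, ∑ a, (U a b).val + ∑ b, ∑ a, (U' a b).val) ∧
    (∑ b, ∑ a, (R a b).val = 0 → ∑ b, ∑ a, (U a b).val ≠ 1 ∧ ∑ b, ∑ a, (U' a b).val ≠ 1) := by
  have hK := fun a => congrArg ZMod.val (hK a)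
  have hU := fun a => congrArg ZMod.val (hU a)
  have hU' := fun a => congrArg ZMod.val (hU' a)
  simp only [Fin.sum_univ_three, ZMod.val_add, ZMod.val_one, ZMod.val_zero, Nat.mod_add_mod,
    Nat.add_mod_mod] at *
  simp only [Fin.forall_fin_succ, Fin.isValue, IsEmpty.forall_iff, and_true] at hK hU hU'
  simp only [Fin.isValue, Fin.succ_zero_eq_one, Fin.succ_one_eq_two, zero_add,
    show (1 : Fin 3) + 1 = 2 from rfl, show (1 : Fin 3) + 2 = 0 from rfl,
    show (2 : Fin 3) + 1 = 0 from rfl, show (2 : Fin 3) + 2 = 1 from rfl] at hK hU hU'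
  obtain ⟨r, hR⟩ := hR
  obtain ⟨hK₀, hK₁, hK₂⟩ := hK
  obtain ⟨hU₀, hU₁, hU₂⟩ := hU
  obtain ⟨hV₀, hV₁, hV₂⟩ := hU'
  refine ⟨?_, ?_, ?_⟩
  · clear hU₀ hU₁ hU₂ hV₀ hV₁ hV₂
    omega
  · clear hU₀ hU₁ hU₂ hV₀ hV₁ hV₂
    omega
  · clear hK₀ hK₁ hK₂
    omega

variable (τ m) in
/-- The number of odd crossings involving the triangle at level `k + 1` or two spokes at that
level. -/
def levelCount (k : Fin n) : ℕ :=
  ∑ l ∈ {k + 1}ᶜ, triTriCount τ m (k + 1) l + ∑ j, triSpokeCount τ m (k + 1) j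
    + spokeSpokeCount τ m k

theorem triTriParity_eq_zero_of_levelCount {k : Fin n} (h : levelCount τ m k = 0) {l : Fin n}
    (hl : l ≠ k + 1) (a b : Fin 3) : triTriParity τ m (k + 1) l a b = 0 := by
  simp only [levelCount, add_eq_zero, Finset.sum_eq_zero_iff] at h
  exact triTriCount_eq_zero (h.1.1 l (by simpa using hl)) a b

theorem triSpokeParity_eq_zero_of_levelCount {k : Fin n} (h : levelCount τ m k = 0)
    (j : Fin n) (a b : Fin 3) : triSpokeParity τ m (k + 1) j a b = 0 := by
  simp only [levelCount, add_eq_zero, Finset.sum_eq_zero_iff] at h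
  exact triSpokeCount_eq_zero (h.1.2 j (Finset.mem_univ j)) a b

theorem spokeSpokeParity_eq_zero_of_levelCount {k : Fin n} (h : levelCount τ m k = 0)
    (a b : Fin 3) : spokeSpokeParity τ m k a b = 0 := by
  simp only [levelCount, add_eq_zero, Finset.sum_eq_zero_iff] at h
  exact spokeSpokeCount_eq_zero h.2 a b

/-- Around a level without odd crossings, the neighbouring triangles cross each other or the
opposite spokes. -/
theorem crossings_near_clean_level (hτ : ∀ u v, u ≠ v → τ u v + τ v u = 1)
    (h₁ : ∀ k : Fin n, k + 1 ≠ k) (h₂ : ∀ k : Fin n, k + 1 + 1 ≠ k) {k : Fin n}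
    (h : levelCount τ m k = 0) :
    1 ≤ triTriCount τ m k (k + 1 + 1) + triSpokeCount τ m k (k + 1)
      + triSpokeCount τ m (k + 1 + 1) k ∧
    (triTriCount τ m k (k + 1 + 1) ≠ 0 →
      3 ≤ triTriCount τ m k (k + 1 + 1) + triSpokeCount τ m k (k + 1)
        + triSpokeCount τ m (k + 1 + 1) k) ∧
    (triTriCount τ m k (k + 1 + 1) = 0 →
      triSpokeCount τ m k (k + 1) ≠ 1 ∧ triSpokeCount τ m (k + 1 + 1) k ≠ 1) := by
  have hs := triSpokeParity_eq_zero_of_levelCount h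
  have ht : ∀ l ≠ k + 1, ∀ a b, triTriParity τ m l (k + 1) a b = 0 := fun l hl a b => by
    rw [triTriParity_comm hτ hl, triTriParity_eq_zero_of_levelCount h hl]
  refine count_of_parity_relations (fun a => ?_) (even_triTriCount k (k + 1 + 1)) (fun a => ?_)
    fun a => ?_
  · have key := sum_parity_around_triangle (m := m) hτ h₁ h₂ k a
    simp only [hs, spokeSpokeParity_eq_zero_of_levelCount h,
      triTriParity_eq_zero_of_levelCount h (h₁ k).symm,
      triTriParity_eq_zero_of_levelCount h (h₁ (k + 1)), Finset.sum_const_zero] at key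
    rw [← key]
    ring
  · have key := sum_triangle_quadrilateral (τ := τ) (m := m) (h₁ k).symm (h₂ k).symm a
    simpa only [ht k (h₁ k).symm, add_zero] using key
  · have key := sum_triangle_quadrilateral (τ := τ) (m := m) (h₂ k) (h₁ (k + 1)) a
    simpa only [ht _ (h₁ (k + 1)), triTriParity_comm hτ (h₂ k), add_zero] using key

variable (τ m) in
/-- The number of pairs of independent edges of `C₃ □ Cₙ` that cross oddly, where of the pairs of
spokes only those at a common level are counted. -/
def oddCrossingCount : ℕ :=
  ∑ k, ∑ l ∈ Finset.Ioi k, triTriCount τ m k l + ∑ k, ∑ j, triSpokeCount τ m k j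
    + ∑ i, spokeSpokeCount τ m i

end TriangleProduct

section SmallCases

/-- The counting behind `four_le_oddCrossingCount`. -/
theorem four_le_of_levels {X Y : Fin 4 → Fin 4 → ℕ} {Z : Fin 4 → ℕ} (hX : ∀ k l, Even (X k l))
    (hX' : ∀ k l, k ≠ l → X k l = X l k)
    (h : ∀ k, ∑ l ∈ {k + 1}ᶜ, X (k + 1) l + ∑ j, Y (k + 1) j + Z k = 0 →
      1 ≤ X k (k + 1 + 1) + Y k (k + 1) + Y (k + 1 + 1) k ∧
      (X k (k + 1 + 1) ≠ 0 → 3 ≤ X k (k + 1 + 1) + Y k (k + 1) + Y (k + 1 + 1) k) ∧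
      (X k (k + 1 + 1) = 0 → Y k (k + 1) ≠ 1 ∧ Y (k + 1 + 1) k ≠ 1)) :
    4 ≤ ∑ k, ∑ l ∈ Finset.Ioi k, X k l + ∑ k, ∑ j, Y k j + ∑ i, Z i := by
  have h0 := h 0
  have h1 := h 1
  have h2 := h 2
  have h3 := h 3
  have := hX' 1 0 (by decide)
  have := hX' 2 0 (by decide)
  have := hX' 3 0 (by decide)
  have := hX' 2 1 (by decide)
  have := hX' 3 1 (by decide)
  have := hX' 3 2 (by decide)
  have := (hX 0 2).two_dvd
  have := (hX 1 3).two_dvd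
  have := (hX 0 1).two_dvd
  have := (hX 0 3).two_dvd
  have := (hX 1 2).two_dvd
  have := (hX 2 3).two_dvd
  clear h hX hX'
  simp only [Fin.sum_univ_four, Fin.reduceAdd, Fin.isValue,
    show ({0}ᶜ : Finset (Fin 4)) = {1, 2, 3} by decide,
    show ({1}ᶜ : Finset (Fin 4)) = {0, 2, 3} by decide,
    show ({2}ᶜ : Finset (Fin 4)) = {0, 1, 3} by decide,
    show ({3}ᶜ : Finset (Fin 4)) = {0, 1, 2} by decide,
    show (Finset.Ioi 0 : Finset (Fin 4)) = {1, 2, 3} by decide,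
    show (Finset.Ioi 1 : Finset (Fin 4)) = {2, 3} by decide,
    show (Finset.Ioi 2 : Finset (Fin 4)) = {3} by decide,
    show (Finset.Ioi 3 : Finset (Fin 4)) = ∅ by decide] at *
  simp only [Finset.sum_insert, Finset.mem_insert, Finset.mem_singleton,
    Finset.sum_singleton, Finset.sum_empty, Fin.isValue, Fin.reduceEq, or_self,
    not_false_eq_true] at *
  omega


theorem five_le_of_level_conditions {x w A B O : Fin 5 → ℕ}
    (h : ∀ k, x (k + 1) + x k + w (k + 1) + w (k + 4) + A (k + 1) + B (k + 1) + O (k + 1) = 0 →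
      (1 ≤ w k ∧ 3 ≤ 2 * w k + A k + B (k + 2)) ∨ 2 ≤ A k ∨ 2 ≤ B (k + 2)) :
    5 ≤ ∑ k, (2 * x k + 2 * w k + A k + B k + O k) := by
  have h0 := h 0
  have h1 := h 1
  have h2 := h 2
  have h3 := h 3
  have h4 := h 4
  clear h
  simp only [Fin.sum_univ_five, Fin.reduceAdd, Fin.isValue] at *
  omega

/-- The counting behind `five_le_oddCrossingCount`. -/
theorem five_le_of_levels {X Y : Fin 5 → Fin 5 → ℕ} {Z : Fin 5 → ℕ} (hX : ∀ k l, Even (X k l))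
    (hX' : ∀ k l, k ≠ l → X k l = X l k)
    (h : ∀ k, ∑ l ∈ {k + 1}ᶜ, X (k + 1) l + ∑ j, Y (k + 1) j + Z k = 0 →
      1 ≤ X k (k + 1 + 1) + Y k (k + 1) + Y (k + 1 + 1) k ∧
      (X k (k + 1 + 1) ≠ 0 → 3 ≤ X k (k + 1 + 1) + Y k (k + 1) + Y (k + 1 + 1) k) ∧
      (X k (k + 1 + 1) = 0 → Y k (k + 1) ≠ 1 ∧ Y (k + 1 + 1) k ≠ 1)) :
    5 ≤ ∑ k, ∑ l ∈ Finset.Ioi k, X k l + ∑ k, ∑ j, Y k j + ∑ i, Z i := by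
  choose x hx using fun k l => (hX k l).two_dvd
  obtain rfl : X = fun k l => 2 * x k l := funext fun k => funext fun l => hx k l
  have hx' : ∀ k l, k ≠ l → x k l = x l k := fun k l hkl => by simpa using hX' k l hkl
  clear hx hX hX'
  refine (five_le_of_level_conditions (x := fun k => x k (k + 1)) (w := fun k => x k (k + 2))
    (A := fun k => Y k (k + 1)) (B := fun k => Y k (k + 3))
    (O := fun k => Y k k + Y k (k + 2) + Y k (k + 4) + Z (k + 4)) fun k hk => ?_).trans
    (le_of_eq ?_)
  · have hk' := h k
    have hc : ∀ k : Fin 5, {k + 1}ᶜ = ({k, k + 1 + 1, k + 1 + 2, k + 4} : Finset (Fin 5)) := by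
      decide
    have e₂ : ∀ k : Fin 5, k + 1 + 1 = k + 2 := by decide
    have e₃ : ∀ k : Fin 5, k + 1 + 2 = k + 3 := by decide
    have e₄ : ∀ k : Fin 5, k + 1 + 3 = k + 4 := by decide
    have e₅ : ∀ k : Fin 5, k + 1 + 4 = k := by decide
    have e₆ : ∀ k : Fin 5, k + 4 + 2 = k + 1 := by decide
    have e₇ : ∀ k : Fin 5, k + 2 + 3 = k := by decide
    have d : ∀ k : Fin 5, Finset.univ = ({k, k + 1, k + 2, k + 3, k + 4} : Finset (Fin 5)) ∧
        [k, k + 1, k + 2, k + 3, k + 4].Nodup := by decide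
    replace d := d k
    simp only [List.nodup_cons, List.mem_cons, List.not_mem_nil, or_false, not_or,
      not_false_eq_true,
      and_true, List.nodup_nil] at d
    obtain ⟨hu, ⟨d₀₁, d₀₂, d₀₃, d₀₄⟩, ⟨d₁₂, d₁₃, d₁₄⟩, ⟨d₂₃, d₂₄⟩, d₃₄⟩ := d
    simp only [e₂, e₃, e₄, e₅, e₆, e₇] at hk hk' hc ⊢
    rw [hc, hu] at hk'
    have := hx' (k + 1) k (Ne.symm d₀₁)
    have := hx' (k + 4) (k + 1) (Ne.symm d₁₄)
    simp only [Finset.sum_insert, Finset.mem_insert, Finset.mem_singleton, Finset.sum_singleton,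
      d₀₁, d₀₂, d₀₃, d₀₄, d₁₂, d₁₃, d₁₄, d₂₃, d₂₄, d₃₄, or_self, not_false_eq_true] at hk'
    omega
  · simp only [Fin.sum_univ_five, Fin.reduceAdd, Fin.isValue,
      show (Finset.Ioi 0 : Finset (Fin 5)) = {1, 2, 3, 4} by decide,
      show (Finset.Ioi 1 : Finset (Fin 5)) = {2, 3, 4} by decide,
      show (Finset.Ioi 2 : Finset (Fin 5)) = {3, 4} by decide,
      show (Finset.Ioi 3 : Finset (Fin 5)) = {4} by decide,
      show (Finset.Ioi 4 : Finset (Fin 5)) = ∅ by decide]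
    simp only [Finset.sum_insert, Finset.mem_insert, Finset.mem_singleton, Finset.sum_singleton,
      Finset.sum_empty, Fin.isValue, Fin.reduceEq, or_self, not_false_eq_true]
    rw [hx' 3 0 (by decide), hx' 4 1 (by decide), hx' 4 0 (by decide)]
    ring

/-- In `C₃ □ C₃`, the triangle between two clean levels crosses the opposite spokes more than twice,
or is involved in another odd crossing. -/
theorem triSpokeCount_ne_two {τ : Fin 3 × Fin 3 → Fin 3 × Fin 3 → ZMod 2}
    {m : Sym2 (Fin 3 × Fin 3) → Fin 3 × Fin 3 → ZMod 2}
    (hτ : ∀ u v, u ≠ v → τ u v + τ v u = 1) {k : Fin 3} (h : levelCount τ m k = 0)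
    (h' : levelCount τ m (k + 1) = 0) (h₁ : triSpokeCount τ m k k = 0)
    (h₂ : triSpokeCount τ m k (k + 2) = 0) (h₃ : spokeSpokeCount τ m (k + 2) = 0) :
    triSpokeCount τ m k (k + 1) ≠ 2 := by
  intro h2
  have e₀ : ∀ k : Fin 3, k + 1 + 1 = k + 2 := by decide
  have e₁ : ∀ k : Fin 3, k + 2 + 1 = k := by decide
  have e₂ : ∀ k : Fin 3, ({k + 2, k}ᶜ : Finset (Fin 3)) = {k + 1} := by decide
  have g₁ : ∀ k : Fin 3, k + 1 ≠ k := by decide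
  have g₂ : ∀ k : Fin 3, k + 2 ≠ k := by decide
  have g₃ : ∀ k : Fin 3, k ≠ k + 1 + 1 := by decide
  have g₄ : ∀ k : Fin 3, k + 1 ≠ k + 2 := by decide
  have t₁ := fun l hl => triTriParity_eq_zero_of_levelCount h (l := l) hl
  have t₂ := fun l hl => triTriParity_eq_zero_of_levelCount h' (l := l) hl
  have s₁ := triSpokeParity_eq_zero_of_levelCount h
  have s₂ := triSpokeParity_eq_zero_of_levelCount h'
  rw [e₀] at t₂ s₂
  have key := fun a => sum_parity_around_triangle (m := m) hτ (by decide) (by decide) (k + 2) a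
  have quad := fun a => sum_triangle_quadrilateral (τ := τ) (m := m) (g₁ k).symm (g₃ k) a
  have c₁ := fun a b => triTriParity_comm (m := m) hτ (g₁ k).symm a b
  have c₂ := fun a b => triTriParity_comm (m := m) hτ (g₂ k).symm a b
  simp only [e₁, e₀, e₂, Finset.sum_singleton, t₁ k (g₁ k).symm, t₂ k (g₂ k).symm,
    t₂ (k + 1) (g₄ k), s₁, s₂, triSpokeCount_eq_zero h₁, triSpokeCount_eq_zero h₂,
    spokeSpokeCount_eq_zero h₃, c₁, c₂, add_zero] at key quad
  have key := fun a => congrArg ZMod.val (key a)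
  have quad := fun a => congrArg ZMod.val (quad a)
  simp only [triSpokeCount, Fin.sum_univ_three, ZMod.val_add, ZMod.val_one, ZMod.val_zero,
    Nat.mod_add_mod, Nat.add_mod_mod] at h2 key quad
  have := key 0; have := key 1; have := key 2
  have q₀ := quad 0; have q₁ := quad 1
  clear key quad
  simp only [Fin.isValue, zero_add, show (1 : Fin 3) + 1 = 2 from rfl] at q₀ q₁
  omega

theorem three_le_of_level_conditions {x A O : Fin 3 → ℕ}
    (h : ∀ k, x (k + 1) + x k + A (k + 1) + O (k + 1) = 0 →
      (1 ≤ x (k + 2) ∧ 3 ≤ 2 * x (k + 2) + A k + A (k + 2)) ∨ 2 ≤ A k ∨ 2 ≤ A (k + 2))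
    (h' : ∀ k, x (k + 1) + x k + A (k + 1) + O (k + 1) = 0 →
      x (k + 2) + x (k + 1) + A (k + 2) + O (k + 2) = 0 → O k = 0 → A k ≠ 2) :
    3 ≤ ∑ k, (2 * x k + A k + O k) := by
  have h0 := h 0
  have h1 := h 1
  have h2 := h 2
  have h0' := h' 0
  have h1' := h' 1
  have h2' := h' 2
  clear h h'
  simp only [Fin.sum_univ_three, Fin.reduceAdd, Fin.isValue] at *
  omega

theorem three_le_oddCrossingCount {τ : Fin 3 × Fin 3 → Fin 3 × Fin 3 → ZMod 2}
    {m : Sym2 (Fin 3 × Fin 3) → Fin 3 × Fin 3 → ZMod 2}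
    (hτ : ∀ u v, u ≠ v → τ u v + τ v u = 1) : 3 ≤ oddCrossingCount τ m := by
  choose x hx using fun k l => (even_triTriCount (τ := τ) (m := m) k l).two_dvd
  have hx' : ∀ k, x k (k + 2) = x (k + 2) k := fun k => by
    have := triTriCount_comm (m := m) hτ (show k ≠ k + 2 by decide +revert)
    simpa [hx] using this
  have hx'' : ∀ k, x (k + 1) k = x k (k + 1) := fun k => by
    have := triTriCount_comm (m := m) hτ (show k + 1 ≠ k by decide +revert)
    simpa [hx] using this
  have e₀ : ∀ k : Fin 3, k + 1 + 1 = k + 2 := by decide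
  have e₁ : ∀ k : Fin 3, k + 2 + 1 = k := by decide
  have e₂ : ∀ k : Fin 3, k + 1 + 2 = k := by decide
  have e₃ : ∀ k : Fin 3, k + 2 + 2 = k + 1 := by decide
  have hlevel : ∀ k, levelCount τ m k = 2 * x (k + 1) (k + 2) + 2 * x k (k + 1)
      + triSpokeCount τ m (k + 1) (k + 2)
      + (triSpokeCount τ m (k + 1) (k + 1) + triSpokeCount τ m (k + 1) k
        + spokeSpokeCount τ m k) := fun k => by
    have hc : ({k + 1}ᶜ : Finset (Fin 3)) = {k + 2, k} := by decide +revert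
    have hu : (Finset.univ : Finset (Fin 3)) = {k + 2, k + 1, k} := by decide +revert
    have n₁ : k + 2 ≠ k := by decide +revert
    have n₂ : k + 1 ≠ k := by decide +revert
    have n₃ : k + 2 ≠ k + 1 := by decide +revert
    rw [levelCount, hc, hu, Finset.sum_pair n₁, Finset.sum_insert (by simp [n₁, n₃]),
      Finset.sum_pair n₂, hx, hx, hx'']
    ring
  refine (three_le_of_level_conditions (x := fun k => x k (k + 1))
    (A := fun k => triSpokeCount τ m k (k + 1))
    (O := fun k => triSpokeCount τ m k k + triSpokeCount τ m k (k + 2)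
      + spokeSpokeCount τ m (k + 2)) (fun k hk => ?_) fun k hk hk' hO => ?_).trans (le_of_eq ?_)
  · have := crossings_near_clean_level (m := m) hτ (by decide) (by decide) (k := k) (by
      have := hlevel k
      simp only [e₀, e₂] at hk
      omega)
    simp only [e₀, e₁, hx, hx'] at this ⊢
    omega
  · refine triSpokeCount_ne_two hτ ?_ ?_ ?_ ?_ ?_
    · have := hlevel k
      simp only [e₀, e₂] at hk
      omega
    · have := hlevel (k + 1)
      simp only [e₀, e₁, e₂, e₃] at hk' this
      omega
    all_goals omega
  · simp only [oddCrossingCount, Fin.sum_univ_three, Fin.isValue, zero_add,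
      show (1 : Fin 3) + 1 = 2 from rfl, show (1 : Fin 3) + 2 = 0 from rfl,
      show (2 : Fin 3) + 1 = 0 from rfl, show (2 : Fin 3) + 2 = 1 from rfl,
      show (Finset.Ioi 0 : Finset (Fin 3)) = {1, 2} by decide,
      show (Finset.Ioi 1 : Finset (Fin 3)) = {2} by decide,
      show (Finset.Ioi 2 : Finset (Fin 3)) = ∅ by decide, Finset.sum_singleton, Finset.sum_empty]
    rw [Finset.sum_pair (by decide), hx, hx, hx, show x 0 2 = x 2 0 from hx' 0]
    ring

theorem four_le_oddCrossingCount {τ : Fin 3 × Fin 4 → Fin 3 × Fin 4 → ZMod 2}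
    {m : Sym2 (Fin 3 × Fin 4) → Fin 3 × Fin 4 → ZMod 2}
    (hτ : ∀ u v, u ≠ v → τ u v + τ v u = 1) : 4 ≤ oddCrossingCount τ m :=
  four_le_of_levels even_triTriCount (fun _ _ => triTriCount_comm hτ)
    fun _ => crossings_near_clean_level hτ (by decide) (by decide)

theorem five_le_oddCrossingCount {τ : Fin 3 × Fin 5 → Fin 3 × Fin 5 → ZMod 2}
    {m : Sym2 (Fin 3 × Fin 5) → Fin 3 × Fin 5 → ZMod 2}
    (hτ : ∀ u v, u ≠ v → τ u v + τ v u = 1) : 5 ≤ oddCrossingCount τ m :=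
  five_le_of_levels even_triTriCount (fun _ _ => triTriCount_comm hτ)
    fun _ => crossings_near_clean_level hτ (by decide) (by decide)

end SmallCases

section LowerBound

/-- The vertices of the two triangles of `G⁶₆₄`. -/
def triangleVertex (c : Fin 2) (a : Fin 3) : Fin 6 := ![![1, 2, 3], ![3, 4, 5]] c a

theorem triangleVertex_injective : ∀ c, Function.Injective (triangleVertex c) := by
  decide

theorem G6_64_adj_triangleVertex (c : Fin 2) (a : Fin 3) :
    G6_64.Adj (triangleVertex c (a + 1)) (triangleVertex c (a + 2)) := by
  simp only [G6_64, fromEdgeSet_adj, Set.mem_insert_iff, Set.mem_singleton_iff]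
  decide +revert

variable {n : ℕ}

/-- The edge opposite to `a` in the copy of the `c`-th triangle at level `k`. -/
def triangleEdge (c : Fin 2) (a : Fin 3) (k : Fin n) : Sym2 (Fin 6 × Fin n) :=
  s((triangleVertex c (a + 1), k), (triangleVertex c (a + 2), k))

theorem triangleEdge_inj {c c' : Fin 2} {a a' : Fin 3} {k k' : Fin n} :
    triangleEdge c a k = triangleEdge c' a' k' ↔ c = c' ∧ a = a' ∧ k = k' := by
  refine ⟨fun h => ?_, fun ⟨h₁, h₂, h₃⟩ => by rw [h₁, h₂, h₃]⟩
  have hf := congrArg (Sym2.map Prod.fst) h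
  have hs := congrArg (Sym2.map Prod.snd) h
  simp only [triangleEdge, Sym2.map_mk, Sym2.eq_iff, or_self] at hf hs
  have : ∀ c c' : Fin 2, ∀ a a' : Fin 3,
      (triangleVertex c (a + 1) = triangleVertex c' (a' + 1) ∧
        triangleVertex c (a + 2) = triangleVertex c' (a' + 2) ∨
        triangleVertex c (a + 1) = triangleVertex c' (a' + 2) ∧
        triangleVertex c (a + 2) = triangleVertex c' (a' + 1)) → c = c' ∧ a = a' := by decide
  exact ⟨(this _ _ _ _ hf).1, (this _ _ _ _ hf).2, hs.1⟩

variable [NeZero n]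

/-- The edge joining the copies of `v` at levels `j` and `j + 1`. -/
def spokeEdge (v : Fin 6) (j : Fin n) : Sym2 (Fin 6 × Fin n) := s((v, j), (v, j + 1))

theorem spokeEdge_inj (h₂ : ∀ k : Fin n, k + 1 + 1 ≠ k) {v v' : Fin 6} {j j' : Fin n} :
    spokeEdge v j = spokeEdge v' j' ↔ v = v' ∧ j = j' := by
  refine ⟨fun h => ?_, fun ⟨h₁, h₂⟩ => by rw [h₁, h₂]⟩
  simp only [spokeEdge, Sym2.eq_iff, Prod.mk.injEq] at h
  rcases h with h | ⟨⟨-, h⟩, -, h'⟩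
  · exact h.1
  · exact absurd (h ▸ h') (h₂ j')

theorem triangleEdge_ne_spokeEdge (h₁ : ∀ k : Fin n, k + 1 ≠ k) {c : Fin 2} {a : Fin 3} {k : Fin n}
    {v : Fin 6} {j : Fin n} : triangleEdge c a k ≠ spokeEdge v j := by
  intro h
  have hs := congrArg (Sym2.map Prod.snd) h
  simp only [triangleEdge, spokeEdge, Sym2.map_mk, Sym2.eq_iff] at hs
  rcases hs with ⟨h, h'⟩ | ⟨h, h'⟩
  · exact h₁ j (h'.symm.trans h)
  · exact h₁ j (h.symm.trans h')

/-- The indices of the pairs of edges of two copies of `C₃ □ Cₙ` counted by `oddCrossingCount`. -/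
abbrev PairIndex (n : ℕ) : Type :=
  Fin 2 × (((Fin n × Fin n) ⊕ (Fin n × Fin n)) ⊕ Fin n) × Fin 3 × Fin 3

/-- The pair of edges with a given index. -/
def edgePair : PairIndex n → Sym2 (Sym2 (Fin 6 × Fin n))
  | (c, .inl (.inl (k, l)), b, a) => s(triangleEdge c a k, triangleEdge c b l)
  | (c, .inl (.inr (k, j)), b, a) => s(triangleEdge c a k, spokeEdge (triangleVertex c b) j)
  | (c, .inr i, b, a) => s(spokeEdge (triangleVertex c a) i, spokeEdge (triangleVertex c b) (i + 1))

/-- The crossing parity of the pair of edges with a given index, zero if this pair is not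
counted. -/
def pairParity (τ : Fin 2 → Fin 3 × Fin n → Fin 3 × Fin n → ZMod 2)
    (m : Fin 2 → Sym2 (Fin 3 × Fin n) → Fin 3 × Fin n → ZMod 2) : PairIndex n → ZMod 2
  | (c, .inl (.inl (k, l)), b, a) => if k < l then triTriParity (τ c) (m c) k l a b else 0
  | (c, .inl (.inr (k, j)), b, a) => triSpokeParity (τ c) (m c) k j a b
  | (c, .inr i, b, a) => spokeSpokeParity (τ c) (m c) i a b

variable {τ : Fin 2 → Fin 3 × Fin n → Fin 3 × Fin n → ZMod 2}
  {m : Fin 2 → Sym2 (Fin 3 × Fin n) → Fin 3 × Fin n → ZMod 2}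

theorem sum_pairParity :
    ∑ i, (pairParity τ m i).val = ∑ c, oddCrossingCount (τ c) (m c) := by
  simp only [Fintype.sum_prod_type, Fintype.sum_sum_type, pairParity, oddCrossingCount]
  refine Finset.sum_congr rfl fun c _ => ?_
  simp only [triTriCount, triSpokeCount, spokeSpokeCount]
  congr 2
  refine Finset.sum_congr rfl fun k _ => ?_
  rw [← Finset.filter_lt_eq_Ioi, Finset.sum_filter]
  refine Finset.sum_congr rfl fun l _ => ?_
  split_ifs <;> simp

theorem edgePair_injOn (h₁ : ∀ k : Fin n, k + 1 ≠ k) (h₂ : ∀ k : Fin n, k + 1 + 1 ≠ k) :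
    Set.InjOn edgePair {i | pairParity τ m i ≠ 0} := by
  have ht := fun {c a k v j} => triangleEdge_ne_spokeEdge h₁
    (c := c) (a := a) (k := k) (v := v) (j := j)
  have hv : ∀ c c' : Fin 2, ∀ a a' b b', a ≠ b → triangleVertex c a = triangleVertex c' a' →
    triangleVertex c b = triangleVertex c' b' → c = c' ∧ a = a' ∧ b = b' := by decide
  rintro ⟨c, (⟨k, l⟩ | ⟨k, j⟩) | i, b, a⟩ h ⟨c', (⟨k', l'⟩ | ⟨k', j'⟩) | i', b', a'⟩ h' he <;>
  simp only [edgePair, Sym2.eq_iff, triangleEdge_inj, spokeEdge_inj h₂, ht, ht.symm, false_and,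
    and_false, or_self, or_false] at he
  · have hkl : k < l := by
      by_contra hkl
      exact h (if_neg hkl)
    have hkl' : k' < l' := by
      by_contra hkl'
      exact h' (if_neg hkl')
    rcases he with ⟨⟨rfl, rfl, rfl⟩, -, rfl, rfl⟩ | ⟨⟨-, -, rfl⟩, -, -, rfl⟩
    · rfl
    · exact absurd hkl hkl'.asymm
  · obtain ⟨⟨rfl, rfl, rfl⟩, hb, rfl⟩ := he
    rw [triangleVertex_injective c hb]
  · have hab : a ≠ b := by
      by_contra hab
      exact h (if_neg (not_not.2 hab))
    rcases he with ⟨⟨ha, rfl⟩, hb, -⟩ | ⟨⟨-, rfl⟩, -, hi⟩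
    · obtain ⟨rfl, rfl, rfl⟩ := hv c c' a a' b b' hab ha hb
      rfl
    · exact absurd hi (h₂ i')

theorem Drawing.mem_image_crossings {V : Type*} {G : SimpleGraph V} (D : Drawing G)
    {τ : V → V → ZMod 2} {m : Sym2 V → V → ZMod 2}
    (h : ∀ a b c d (e f : G.edgeSet), (e : Sym2 V) = s(a, b) → (f : Sym2 V) = s(c, d) →
        a ≠ c → a ≠ d → b ≠ c → b ≠ d →
        (∀ s ∈ Set.Ioo (0 : ℝ) 1, ∀ t ∈ Set.Ioo (0 : ℝ) 1, D.arc e s ≠ D.arc f t) →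
        crossingParity τ m a b c d = 0) {a b c d : V} (hab : G.Adj a b) (hcd : G.Adj c d)
    (hac : a ≠ c) (had : a ≠ d) (hbc : b ≠ c) (hbd : b ≠ d) (hne : crossingParity τ m a b c d ≠ 0) :
    s(s(a, b), s(c, d)) ∈ (fun x => x.1.map Subtype.val) '' D.crossings := by
  by_contra hnot
  refine hne (h a b c d ⟨s(a, b), hab⟩ ⟨s(c, d), hcd⟩ rfl rfl hac had hbc hbd fun s hs t ht heq =>
    hnot ⟨(s(⟨s(a, b), hab⟩, ⟨s(c, d), hcd⟩), _),
      ⟨_, _, ?_, rfl, ⟨s, hs, rfl⟩, t, ht, heq.symm⟩, rfl⟩)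
  intro hef
  have := congrArg Subtype.val hef
  simp [hac, had] at this

/-- If every drawing of `C₃ □ C` has `N` odd crossings, then `G⁶₆₄ □ C` has crossing number at least
`2 * N`. -/
theorem two_mul_le_ncard_crossings {C : SimpleGraph (Fin n)} (hC : ∀ k, C.Adj k (k + 1))
    (h₂ : ∀ k : Fin n, k + 1 + 1 ≠ k) {N : ℕ}
    (hN : ∀ (τ : Fin 3 × Fin n → Fin 3 × Fin n → ZMod 2)
      (m : Sym2 (Fin 3 × Fin n) → Fin 3 × Fin n → ZMod 2),
      (∀ u v, u ≠ v → τ u v + τ v u = 1) → N ≤ oddCrossingCount τ m)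
    (D : Drawing (G6_64 □ C)) (hD : D.crossings.Finite) : 2 * N ≤ D.crossings.ncard := by
  obtain ⟨τ, m, hτ, hm⟩ := D.exists_crossingParity
  have h₁ : ∀ k : Fin n, k + 1 ≠ k := fun k => (hC k).ne'
  have ha₁ : ∀ a : Fin 3, a + 1 ≠ a := by decide
  have ha₂ : ∀ a : Fin 3, a + 2 ≠ a := by decide
  have hadjT : ∀ c a (k : Fin n), (G6_64 □ C).Adj (triangleVertex c (a + 1), k)
      (triangleVertex c (a + 2), k) := fun c a k =>
    boxProd_adj.2 (.inl ⟨G6_64_adj_triangleVertex c a, rfl⟩)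
  have hadjS : ∀ v (j : Fin n), (G6_64 □ C).Adj (v, j) (v, j + 1) := fun v j =>
    boxProd_adj.2 (.inr ⟨hC j, rfl⟩)
  let ι : Fin 2 → Fin 3 × Fin n → Fin 6 × Fin n := fun c v => (triangleVertex c v.1, v.2)
  let τ' : Fin 2 → Fin 3 × Fin n → Fin 3 × Fin n → ZMod 2 := fun c u v => τ (ι c u) (ι c v)
  let m' : Fin 2 → Sym2 (Fin 3 × Fin n) → Fin 3 × Fin n → ZMod 2 :=
    fun c e v => m (e.map (ι c)) (ι c v)
  have hι : ∀ c, Function.Injective (ι c) := fun c u v h => by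
    simp only [ι, Prod.mk.injEq] at h
    exact Prod.ext (triangleVertex_injective c h.1) h.2
  have hne : ∀ c u v, u ≠ v → ι c u ≠ ι c v := fun c u v h => (hι c).ne h
  have hsub : edgePair '' {i | pairParity τ' m' i ≠ 0} ⊆
      (fun x => x.1.map Subtype.val) '' D.crossings := by
    rintro _ ⟨⟨c, (⟨k, l⟩ | ⟨k, j⟩) | i, b, a⟩, h, rfl⟩
    · by_cases hkl : k < l
      · refine D.mem_image_crossings hm (hadjT c a k) (hadjT c b l) ?_ ?_ ?_ ?_
          fun h0 => h ((if_pos hkl).trans h0) <;> simp [hkl.ne]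
      · exact absurd (if_neg hkl) h
    · by_cases hkj : k ≠ j ∧ k ≠ j + 1 ∨ a = b
      · have hd : ∀ a' l, a' ≠ a → l = j ∨ l = j + 1 →
            (triangleVertex c a', k) ≠ (triangleVertex c b, l) := fun a' l ha hl he => by
          rw [Prod.mk.injEq] at he
          rcases hkj with hkj | rfl
          · rcases hl with rfl | rfl
            exacts [hkj.1 he.2, hkj.2 he.2]
          · exact ha (triangleVertex_injective c he.1)
        exact D.mem_image_crossings hm (hadjT c a k) (hadjS _ j) (hd _ _ (ha₁ a) (.inl rfl))
          (hd _ _ (ha₁ a) (.inr rfl)) (hd _ _ (ha₂ a) (.inl rfl)) (hd _ _ (ha₂ a) (.inr rfl))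
          fun h0 => h ((if_pos hkj).trans h0)
      · exact absurd (if_neg hkj) h
    · by_cases hab : a ≠ b
      · refine D.mem_image_crossings hm (hadjS _ i) (hadjS _ (i + 1)) ?_ ?_ ?_ ?_
          fun h0 => h ((if_pos hab).trans h0) <;> simp [(triangleVertex_injective c).eq_iff, hab]
      · exact absurd (if_neg hab) h
  calc 2 * N ≤ ∑ c, oddCrossingCount (τ' c) (m' c) := by
        rw [Fin.sum_univ_two, two_mul]
        exact add_le_add (hN _ _ fun u v h => hτ _ _ (hne _ _ _ h))
          (hN _ _ fun u v h => hτ _ _ (hne _ _ _ h))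
    _ = ∑ i, (pairParity τ' m' i).val := sum_pairParity.symm
    _ ≤ ∑ i with pairParity τ' m' i ≠ 0, 1 := by
        rw [Finset.sum_filter]
        refine Finset.sum_le_sum fun i _ => ?_
        generalize pairParity τ' m' i = x
        revert x
        decide
    _ = {i | pairParity τ' m' i ≠ 0}.ncard := by
        rw [← Finset.card_eq_sum_ones, Set.ncard_eq_toFinset_card']
        simp
    _ = (edgePair '' {i | pairParity τ' m' i ≠ 0}).ncard :=
        (Set.InjOn.ncard_image (edgePair_injOn h₁ h₂)).symm
    _ ≤ ((fun x => x.1.map Subtype.val) '' D.crossings).ncard :=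
        Set.ncard_le_ncard hsub (hD.image _)
    _ ≤ D.crossings.ncard := Set.ncard_image_le hD

end LowerBound

section UpperBound

/-- Twice the signed area of the triangle `abc`. -/
def orientation {R : Type*} [Ring R] (a b c : R × R) : R :=
  (b.1 - a.1) * (c.2 - a.2) - (b.2 - a.2) * (c.1 - a.1)

theorem orientation_lineMap (a b c d : ℝ × ℝ) (t : ℝ) :
    orientation a b (AffineMap.lineMap c d t) =
      (1 - t) * orientation a b c + t * orientation a b d := by
  simp only [orientation, AffineMap.lineMap_apply, vsub_eq_sub, vadd_eq_add, Prod.fst_add,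
    Prod.snd_add, Prod.smul_fst, Prod.smul_snd, smul_eq_mul, Prod.fst_sub, Prod.snd_sub]
  ring

theorem orientation_lineMap_self (a b : ℝ × ℝ) (t : ℝ) :
    orientation a b (AffineMap.lineMap a b t) = 0 := by
  rw [orientation_lineMap, orientation, orientation]
  ring

/-- The segments `ab` and `cd` do not cross if `c` and `d` lie on the same side of the line `ab`. -/
theorem lineMap_ne_lineMap {a b c d : ℝ × ℝ}
    (h : orientation a b c ≠ 0 ∨ orientation a b d ≠ 0)
    (h' : 0 ≤ orientation a b c * orientation a b d) {s t : ℝ} (ht : t ∈ Set.Ioo (0 : ℝ) 1) :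
    AffineMap.lineMap a b s ≠ AffineMap.lineMap c d t := by
  intro he
  have key := orientation_lineMap a b c d t
  rw [← he, orientation_lineMap_self] at key
  obtain ⟨h0, h1⟩ := ht
  have h1' : 0 < 1 - t := sub_pos.2 h1
  generalize orientation a b c = A at *
  generalize orientation a b d = B at *
  have hA : A = 0 := by
    have : (1 - t) * A ^ 2 + t * (A * B) = 0 := by linear_combination -A * key
    have : A ^ 2 = 0 := by nlinarith [mul_nonneg h0.le h', mul_nonneg h1'.le (sq_nonneg A)]
    exact pow_eq_zero_iff two_ne_zero |>.1 this
  subst hA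
  simp [h0.ne'] at key
  simp [key] at h

theorem lineMap_unique {a b c d : ℝ × ℝ} (h : orientation a b c ≠ 0 ∨ orientation a b d ≠ 0)
    {s t s' t' : ℝ} (he : (AffineMap.lineMap a b s : ℝ × ℝ) = AffineMap.lineMap c d t)
    (he' : (AffineMap.lineMap a b s' : ℝ × ℝ) = AffineMap.lineMap c d t') : t = t' := by
  have key := orientation_lineMap a b c d t
  have key' := orientation_lineMap a b c d t'
  rw [← he, orientation_lineMap_self] at key
  rw [← he', orientation_lineMap_self] at key'
  by_contra hne
  have hne : t - t' ≠ 0 := sub_ne_zero.2 hne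
  have hA : (t - t') * orientation a b c = 0 := by linear_combination t' * key - t * key'
  have hB : (t - t') * orientation a b d = 0 := by
    linear_combination (1 - t) * key' - (1 - t') * key
  rcases h with h | h
  exacts [h ((mul_eq_zero.1 hA).resolve_left hne), h ((mul_eq_zero.1 hB).resolve_left hne)]

/-- The real point with given integer coordinates. -/
def realPoint (a : ℤ × ℤ) : ℝ × ℝ := (a.1, a.2)

theorem orientation_realPoint (a b c : ℤ × ℤ) :
    orientation (realPoint a) (realPoint b) (realPoint c) = orientation a b c := by
  simp [orientation, realPoint]

theorem realPoint_injective : Function.Injective realPoint := fun a b h => by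
  simpa [realPoint, Prod.ext_iff] using h

/-- A straight-line drawing with vertices at integer points, in which only the pairs of edges in `K`
cross. -/
theorem exists_drawing_of_positions {V ι : Type*} {G : SimpleGraph V} {p : V → ℤ × ℤ}
    {edge : ι → V × V} (hG : ∀ e ∈ G.edgeSet, ∃ i, e = s((edge i).1, (edge i).2))
    (hp : Function.Injective p) (hv : ∀ i w, w ≠ (edge i).1 → w ≠ (edge i).2 →
      orientation (p (edge i).1) (p (edge i).2) (p w) ≠ 0)
    {K : Finset (Sym2 ι)} (hne : ∀ i j, i ≠ j →
      (orientation (p (edge i).1) (p (edge i).2) (p (edge j).1) ≠ 0 ∨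
        orientation (p (edge i).1) (p (edge i).2) (p (edge j).2) ≠ 0))
    (hK : ∀ i j, i ≠ j → 0 ≤ orientation (p (edge i).1) (p (edge i).2) (p (edge j).1) *
        orientation (p (edge i).1) (p (edge i).2) (p (edge j).2) ∨
      0 ≤ orientation (p (edge j).1) (p (edge j).2) (p (edge i).1) *
        orientation (p (edge j).1) (p (edge j).2) (p (edge i).2) ∨ s(i, j) ∈ K) :
    ∃ D : Drawing G, D.crossings.Finite ∧ D.crossings.ncard ≤ K.card := by
  choose idx hidx using fun e : G.edgeSet => hG e e.2
  have hidx_inj : Function.Injective idx := fun e f h => Subtype.ext (by rw [hidx e, hidx f, h])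
  let q : V → ℝ × ℝ := fun v => realPoint (p v)
  have hq : Function.Injective q := realPoint_injective.comp hp
  have hadj : ∀ e, (edge (idx e)).1 ≠ (edge (idx e)).2 := fun e h => by
    have := e.2
    rw [hidx e, mem_edgeSet, h] at this
    exact this.ne rfl
  have hor : ∀ u v w, orientation (q u) (q v) (q w) = orientation (p u) (p v) (p w) :=
    fun u v w => orientation_realPoint _ _ _
  have hinj : ∀ e, Function.Injective
      (AffineMap.lineMap (q (edge (idx e)).1) (q (edge (idx e)).2) : ℝ → ℝ × ℝ) := fun e =>
    AffineMap.lineMap_injective ℝ (hq.ne (hadj e))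
  let D : Drawing G :=
    { vertexMap := q
      vertexMap_injective := hq
      arc := fun e => AffineMap.lineMap (q (edge (idx e)).1) (q (edge (idx e)).2)
      arc_continuousOn := fun e => AffineMap.lineMap_continuous.continuousOn
      arc_injOn := fun e => (hinj e).injOn
      arc_endpoints := fun e => ⟨_, _, hidx e, AffineMap.lineMap_apply_zero _ _,
        AffineMap.lineMap_apply_one _ _⟩
      arc_avoids_vertices := fun e t ht w h => by
        by_cases h1 : w = (edge (idx e)).1
        · exact ht.1.ne' (hinj e (h.trans (by rw [h1, AffineMap.lineMap_apply_zero])))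
        by_cases h2 : w = (edge (idx e)).2
        · exact ht.2.ne (hinj e (h.trans (by rw [h2, AffineMap.lineMap_apply_one])))
        · have := orientation_lineMap_self (q (edge (idx e)).1) (q (edge (idx e)).2) t
          rw [h, hor, Int.cast_eq_zero] at this
          exact hv _ _ h1 h2 this }
  have hmaps : Set.MapsTo (fun x => x.1.map idx) D.crossings (K : Set (Sym2 ι)) := by
    rintro ⟨_, z⟩ ⟨e, f, hef, rfl, ⟨s, hs, hes⟩, t, ht, hft⟩
    have hij := hidx_inj.ne hef
    rcases hK _ _ hij with h | h | h
    · refine absurd (hes.trans hft.symm) (lineMap_ne_lineMap ?_ ?_ ht)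
      · simpa only [hor, ne_eq, Int.cast_eq_zero] using hne _ _ hij
      · simp only [hor]
        exact_mod_cast h
    · refine absurd (hft.trans hes.symm) (lineMap_ne_lineMap ?_ ?_ hs)
      · simpa only [hor, ne_eq, Int.cast_eq_zero] using hne _ _ hij.symm
      · simp only [hor]
        exact_mod_cast h
    · exact h
  have hinjOn : Set.InjOn (fun x => x.1.map idx) D.crossings := by
    rintro ⟨_, z⟩ ⟨e, f, hef, rfl, ⟨s, hs, hes⟩, t, ht, hft⟩ ⟨x, z'⟩ ⟨e', f', -, hx, hs', ht'⟩ h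
    obtain rfl := Sym2.map.injective hidx_inj h
    have : (∃ s' ∈ Set.Ioo (0 : ℝ) 1, D.arc e s' = z') ∧
        ∃ t' ∈ Set.Ioo (0 : ℝ) 1, D.arc f t' = z' := by
      rcases Sym2.eq_iff.1 hx with ⟨rfl, rfl⟩ | ⟨rfl, rfl⟩
      exacts [⟨hs', ht'⟩, ⟨ht', hs'⟩]
    obtain ⟨⟨s', -, hes'⟩, t', -, hft'⟩ := this
    have htt : t = t' := by
      refine lineMap_unique ?_ (hes.trans hft.symm) (hes'.trans hft'.symm)
      simpa only [hor, ne_eq, Int.cast_eq_zero] using hne _ _ (hidx_inj.ne hef)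
    exact Prod.ext rfl (hft.symm.trans (htt ▸ hft'))
  refine ⟨D, Set.Finite.of_injOn hmaps hinjOn K.finite_toSet, ?_⟩
  rw [← Set.ncard_coe_finset K]
  exact Set.ncard_le_ncard_of_injOn _ hmaps hinjOn K.finite_toSet

end UpperBound

section Positions

/-- The edges of `G6_64 □ cycleGraph n`: the pair `(q, i)` stands for an edge of the `i`-th copy of
`G6_64` if `q < 7`, and for an edge from level `i` to level `i + 1` otherwise. -/
def productEdge (n : ℕ) [NeZero n] (x : Fin 13 × Fin n) : (Fin 6 × Fin n) × (Fin 6 × Fin n) :=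
  ((![0, 1, 2, 3, 4, 1, 3, 0, 1, 2, 3, 4, 5] x.1, x.2),
    (![1, 2, 3, 4, 5, 3, 5, 0, 1, 2, 3, 4, 5] x.1, if x.1 < 7 then x.2 else x.2 + 1))

theorem exists_eq_productEdge {n : ℕ} (e) (he : e ∈ (G6_64 □ cycleGraph (n + 2)).edgeSet) :
    ∃ x, e = s((productEdge (n + 2) x).1, (productEdge (n + 2) x).2) := by
  induction e with | _ a b
  obtain ⟨u, i⟩ := a
  obtain ⟨v, j⟩ := b
  rw [mem_edgeSet, boxProd_adj] at he
  rcases he with ⟨h, hij⟩ | ⟨h, huv⟩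
  · obtain rfl : i = j := hij
    have hq : ∃ q : Fin 7, s(u, v) =
        s((![0, 1, 2, 3, 4, 1, 3] q : Fin 6), ![1, 2, 3, 4, 5, 3, 5] q) := by
      have := (fromEdgeSet_adj _).1 h |>.1
      simp only [Set.mem_insert_iff, Set.mem_singleton_iff] at this
      rcases this with h | h | h | h | h | h | h
      exacts [⟨0, h⟩, ⟨1, h⟩, ⟨2, h⟩, ⟨3, h⟩, ⟨4, h⟩, ⟨5, h⟩, ⟨6, h⟩]
    obtain ⟨q, hq⟩ := hq
    have := congrArg (Sym2.map fun w => (w, i)) hq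
    simp only [Sym2.map_mk] at this
    rw [this]
    refine ⟨(q.castLE (by norm_num), i), ?_⟩
    fin_cases q <;> rfl
  · obtain rfl : u = v := huv
    have hu : ∀ k : Fin (n + 2), s((u, k), (u, k + 1)) =
        s((productEdge (n + 2) (Fin.natAdd 7 u, k)).1,
          (productEdge (n + 2) (Fin.natAdd 7 u, k)).2) := by
      intro k
      fin_cases u <;> rfl
    rcases cycleGraph_adj.1 h with h | h
    · obtain rfl := sub_eq_iff_eq_add'.1 h
      exact ⟨_, Sym2.eq_swap.trans (hu j)⟩
    · obtain rfl := sub_eq_iff_eq_add'.1 h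
      exact ⟨_, hu i⟩

/-- Six concentric copies of the polygon `b`, scaled and rotated by Gaussian integers. -/
def concentricPosition {n : ℕ} (b : Fin n → ℤ × ℤ) (x : Fin 6 × Fin n) : ℤ × ℤ :=
  let c : ℤ × ℤ := ![(1, 0), (5, 1), (18, 2), (37, 3), (147, 9), (588, -103)] x.1
  (c.1 * (b x.2).1 - c.2 * (b x.2).2, c.1 * (b x.2).2 + c.2 * (b x.2).1)

/-- The straight-line drawing on concentric copies of `b` has the chord from `1` to `3` of each
level crossing an edge at `2`, the chord from `3` to `5` crossing an edge at `4`, and no other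
crossings. -/
def ConcentricDrawingValid {n : ℕ} [NeZero n] (b : Fin n → ℤ × ℤ) : Prop :=
  (∀ u i v j, concentricPosition b (u, i) = concentricPosition b (v, j) → u = v ∧ i = j) ∧
  (∀ q i v j, (v, j) ≠ (productEdge n (q, i)).1 → (v, j) ≠ (productEdge n (q, i)).2 →
    orientation (concentricPosition b (productEdge n (q, i)).1)
      (concentricPosition b (productEdge n (q, i)).2) (concentricPosition b (v, j)) ≠ 0) ∧
  ∀ q i q' i', (q = q' ∧ i = i') ∨
    let a := concentricPosition b (productEdge n (q, i)).1
    let a' := concentricPosition b (productEdge n (q, i)).2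
    let c := concentricPosition b (productEdge n (q', i')).1
    let c' := concentricPosition b (productEdge n (q', i')).2
    (orientation a a' c ≠ 0 ∨ orientation a a' c' ≠ 0) ∧
    (0 ≤ orientation a a' c * orientation a a' c' ∨ 0 ≤ orientation c c' a * orientation c c' a' ∨
      (q = 5 ∧ q' = 9 ∧ i' = i - 1) ∨ (q = 6 ∧ q' = 11 ∧ i' = i - 1) ∨
      (q' = 5 ∧ q = 9 ∧ i = i' - 1) ∨ (q' = 6 ∧ q = 11 ∧ i = i' - 1))

instance {n : ℕ} [NeZero n] (b : Fin n → ℤ × ℤ) : Decidable (ConcentricDrawingValid b) := by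
  unfold ConcentricDrawingValid
  infer_instance

theorem ConcentricDrawingValid.exists_drawing {n : ℕ} {b : Fin (n + 2) → ℤ × ℤ}
    (h : ConcentricDrawingValid b) : ∃ D : Drawing (G6_64 □ cycleGraph (n + 2)),
      D.crossings.Finite ∧ D.crossings.ncard ≤ 2 * (n + 2) := by
  obtain ⟨hp, hv, hcr⟩ := h
  let f : Fin 2 × Fin (n + 2) → Sym2 (Fin 13 × Fin (n + 2)) := fun x =>
    s((![5, 6] x.1, x.2), (![9, 11] x.1, x.2 - 1))
  have hcr' := fun x y : Fin 13 × Fin (n + 2) => fun hxy : x ≠ y =>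
    (hcr x.1 x.2 y.1 y.2).resolve_left fun h => hxy (Prod.ext h.1 h.2)
  obtain ⟨D, hD, hcard⟩ := exists_drawing_of_positions (K := Finset.univ.image f)
    exists_eq_productEdge (fun x y hxy => Prod.ext_iff.2 (hp _ _ _ _ hxy))
    (fun x w => hv x.1 x.2 w.1 w.2) (fun x y hxy => (hcr' x y hxy).1) fun x y hxy => by
      refine (hcr' x y hxy).2.imp_right (Or.imp_right fun h => ?_)
      obtain ⟨q, i⟩ := x
      obtain ⟨q', i'⟩ := y
      refine Finset.mem_image.2 ?_
      rcases h with ⟨rfl, rfl, rfl⟩ | ⟨rfl, rfl, rfl⟩ | ⟨rfl, rfl, rfl⟩ | ⟨rfl, rfl, rfl⟩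
      exacts [⟨(0, i), Finset.mem_univ _, rfl⟩, ⟨(1, i), Finset.mem_univ _, rfl⟩,
        ⟨(0, i'), Finset.mem_univ _, Sym2.eq_swap⟩, ⟨(1, i'), Finset.mem_univ _, Sym2.eq_swap⟩]
  refine ⟨D, hD, hcard.trans (Finset.card_image_le.trans ?_)⟩
  simp

theorem crossingNumber_G6_64_boxProd_cycleGraph {n : ℕ} {b : Fin (n + 2) → ℤ × ℤ}
    (hb : ConcentricDrawingValid b) (h₂ : ∀ k : Fin (n + 2), k + 1 + 1 ≠ k)
    (hN : ∀ (τ : Fin 3 × Fin (n + 2) → Fin 3 × Fin (n + 2) → ZMod 2)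
      (m : Sym2 (Fin 3 × Fin (n + 2)) → Fin 3 × Fin (n + 2) → ZMod 2),
      (∀ u v, u ≠ v → τ u v + τ v u = 1) → n + 2 ≤ oddCrossingCount τ m) :
    crossingNumber (G6_64 □ cycleGraph (n + 2)) = 2 * (n + 2) := by
  have hC : ∀ k : Fin (n + 2), (cycleGraph (n + 2)).Adj k (k + 1) := fun k =>
    cycleGraph_adj.2 (.inr (add_sub_cancel_left k 1))
  obtain ⟨D, hD, hcard⟩ := hb.exists_drawing
  have hle : crossingNumber (G6_64 □ cycleGraph (n + 2)) ≤ D.crossings.ncard :=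
    Nat.sInf_le ⟨D, hD, rfl⟩
  refine le_antisymm (hle.trans hcard) (le_csInf ⟨_, D, hD, rfl⟩ ?_)
  rintro _ ⟨D', hD', rfl⟩
  exact two_mul_le_ncard_crossings hC h₂ hN D' hD'

theorem triangle_valid : ConcentricDrawingValid ![(2, 0), (-1, 2), (-1, -2)] := by
  decide +kernel

theorem square_valid : ConcentricDrawingValid ![(1, 0), (0, 1), (-1, 0), (0, -1)] := by
  decide +kernel

theorem pentagon_valid :
    ConcentricDrawingValid ![(10, 0), (3, 10), (-8, 6), (-8, -6), (3, -10)] := by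
  decide +kernel

end Positions

/-- The crossing numbers of `G⁶₆₄ □ C₃`, `G⁶₆₄ □ C₄` and `G⁶₆₄ □ C₅` are
`6`, `8` and `10` respectively. -/
theorem crossingNumber_G6_64_boxProd_smallCycles :
    crossingNumber (G6_64 □ SimpleGraph.cycleGraph 3) = 6 ∧
    crossingNumber (G6_64 □ SimpleGraph.cycleGraph 4) = 8 ∧
    crossingNumber (G6_64 □ SimpleGraph.cycleGraph 5) = 10 :=
  ⟨crossingNumber_G6_64_boxProd_cycleGraph triangle_valid (by decide)
      fun _ _ => three_le_oddCrossingCount,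
    crossingNumber_G6_64_boxProd_cycleGraph square_valid (by decide)
      fun _ _ => four_le_oddCrossingCount,
    crossingNumber_G6_64_boxProd_cycleGraph pentagon_valid (by decide)
      fun _ _ => five_le_oddCrossingCount⟩
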